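/- arXiv:2102.12467 — 5 statements merged into one kernel-verified Lean document; each statement's English description precedes it below -/
import Mathlib

section
/- Fix m ∈ ℕ, a, b ∈ ℝᵐ, Δ > 0 with ‖a − b‖₂ ≤ Δ, ε ∈ (0,1), δ ∈ (0,1), and c > 0 with c² > 2·ln(1.25/δ). Let σ ≥ c·Δ/ε, and let μ_a and μ_b be the product measures on ℝᵐ whose i-th coordinates are real Gaussian measures with means a_i and b_i respectively, each with variance σ². Then for every measurable set S ⊆ ℝᵐ, μ_a(S) ≤ e^ε · μ_b(S) + δ. -/
open MeasureTheory ProbabilityTheory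

/-- Tonelli's theorem for a product of functions of one coordinate each. -/
theorem lintegral_pi_fin_prod {n : ℕ} {E : Fin n → Type*} [∀ i, MeasurableSpace (E i)]
    (μ : ∀ i, Measure (E i)) [∀ i, SigmaFinite (μ i)] {f : ∀ i, E i → ENNReal}
    (hf : ∀ i, Measurable (f i)) :
    ∫⁻ x, ∏ i, f i (x i) ∂Measure.pi μ = ∏ i, ∫⁻ x, f i x ∂μ i := by
  induction n with
  | zero => simp
  | succ n ih =>
    rw [← (measurePreserving_piFinSuccAbove μ 0).symm.lintegral_comp_emb
      (MeasurableEquiv.measurableEmbedding _)]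
    simp_rw [MeasurableEquiv.piFinSuccAbove_symm_apply, Fin.insertNthEquiv,
      Fin.prod_univ_succ, Fin.insertNth_zero, Equiv.coe_fn_mk, Fin.cons_succ, Fin.cons_zero]
    have h := lintegral_prod_mul (μ := μ 0) (ν := Measure.pi fun i : Fin n ↦ μ i.succ)
      (hf 0).aemeasurable
      (g := fun x ↦ ∏ i : Fin n, f i.succ (x i))
      (Finset.measurable_fun_prod _ fun i _ ↦
        (hf i.succ).comp (measurable_pi_apply i)).aemeasurable
    rw [ih (fun i : Fin n ↦ μ i.succ) fun i ↦ hf i.succ] at h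
    exact h

theorem pi_withDensity {n : ℕ} {E : Fin n → Type*} [∀ i, MeasurableSpace (E i)]
    (μ : ∀ i, Measure (E i)) [∀ i, SigmaFinite (μ i)] {f : ∀ i, E i → ENNReal}
    (hf : ∀ i, Measurable (f i)) [∀ i, SigmaFinite ((μ i).withDensity (f i))] :
    Measure.pi (fun i ↦ (μ i).withDensity (f i)) =
      (Measure.pi μ).withDensity fun x ↦ ∏ i, f i (x i) := by
  refine Measure.pi_eq fun s hs ↦ ?_
  rw [withDensity_apply _ (MeasurableSet.univ_pi hs), Measure.restrict_pi_pi,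
    lintegral_pi_fin_prod _ hf]
  exact Finset.prod_congr rfl fun i _ ↦ (withDensity_apply _ (hs i)).symm

theorem pi_gaussianReal_eq_withDensity {n : ℕ} (a : Fin n → ℝ) {v : NNReal} (hv : v ≠ 0) :
    Measure.pi (fun i ↦ gaussianReal (a i) v) =
      (volume : Measure (Fin n → ℝ)).withDensity
        fun x ↦ ENNReal.ofReal (∏ i, gaussianPDFReal (a i) v (x i)) := by
  have hσ (i : Fin n) : SigmaFinite (volume.withDensity (gaussianPDF (a i) v)) := by
    rw [← gaussianReal_of_var_ne_zero (a i) hv]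
    infer_instance
  simp_rw [gaussianReal_of_var_ne_zero _ hv]
  rw [pi_withDensity _ fun i ↦ measurable_gaussianPDF (a i) v, ← volume_pi]
  simp_rw [gaussianPDF, ENNReal.ofReal_prod_of_nonneg fun i _ ↦ gaussianPDFReal_nonneg _ _ _]

theorem prod_gaussianPDFReal {n : ℕ} (a x : Fin n → ℝ) (v : NNReal) :
    ∏ i, gaussianPDFReal (a i) v (x i) =
      (√(2 * Real.pi * v))⁻¹ ^ n * Real.exp (-(∑ i, (x i - a i) ^ 2) / (2 * v)) := by
  simp_rw [gaussianPDFReal, Finset.prod_mul_distrib, ← Real.exp_sum, ← Finset.sum_div,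
    Finset.sum_neg_distrib]
  simp

theorem one_sub_exp_neg_le {α : ℝ} (hα : 1 / 2 ≤ α) (t : ℝ) :
    1 - Real.exp (-t) ≤ 1 / 2 * Real.exp (α * t) := by
  rcases le_total t 0 with ht | ht
  · have h : 1 ≤ Real.exp (-t) := Real.one_le_exp (by linarith)
    linarith [Real.exp_pos (α * t)]
  · have hmono : Real.exp (t / 2) ≤ Real.exp (α * t) := Real.exp_le_exp.2 (by nlinarith)
    have hmul : Real.exp (-t) * Real.exp (t / 2) ^ 2 = 1 := by
      rw [← Real.exp_nat_mul, ← Real.exp_add]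
      simp
      ring
    have hs := Real.exp_pos (t / 2)
    have hr := Real.exp_pos (-t)
    set s := Real.exp (t / 2)
    have h : 1 - Real.exp (-t) ≤ 1 / 2 * s := by
      have h1 : 0 ≤ (1 / 2 * s - 1 + Real.exp (-t)) * s ^ 2 := by
        nlinarith [mul_nonneg (by linarith : (0 : ℝ) ≤ s + 2 / 3) (sq_nonneg (s - 4 / 3))]
      linarith [nonneg_of_mul_nonneg_left h1 (by positivity)]
    linarith

/-- The likelihood-ratio tail is dominated by the Gaussian density with extrapolated mean
`a + α (a - b)`. -/
theorem prod_gaussianPDFReal_le {n : ℕ} (a b x : Fin n → ℝ) {v : NNReal} (hv : v ≠ 0)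
    {α : ℝ} (hα : 1 / 2 ≤ α) (ε : ℝ) :
    ∏ i, gaussianPDFReal (a i) v (x i) ≤
      Real.exp ε * ∏ i, gaussianPDFReal (b i) v (x i) +
        1 / 2 * Real.exp (α * (α + 1) * (∑ i, (a i - b i) ^ 2) / (2 * v) - α * ε) *
          ∏ i, gaussianPDFReal (a i + α * (a i - b i)) v (x i) := by
  have hv' : (v : ℝ) ≠ 0 := by exact_mod_cast hv
  rw [prod_gaussianPDFReal, prod_gaussianPDFReal,
    prod_gaussianPDFReal fun i ↦ a i + α * (a i - b i)]
  have hsum : ∑ i, (x i - (a i + α * (a i - b i))) ^ 2 =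
      (1 + α) * ∑ i, (x i - a i) ^ 2 - α * ∑ i, (x i - b i) ^ 2 +
        α * (α + 1) * ∑ i, (a i - b i) ^ 2 := by
    simp_rw [Finset.mul_sum, ← Finset.sum_sub_distrib, ← Finset.sum_add_distrib]
    exact Finset.sum_congr rfl fun i _ ↦ by ring
  rw [hsum]
  generalize ∑ i, (x i - a i) ^ 2 = A
  generalize ∑ i, (x i - b i) ^ 2 = B
  generalize ∑ i, (a i - b i) ^ 2 = N
  have key := mul_le_mul_of_nonneg_left (one_sub_exp_neg_le hα ((B - A) / (2 * v) - ε))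
    (Real.exp_pos (-A / (2 * v))).le
  have h₁ : Real.exp (-A / (2 * v)) * Real.exp (-((B - A) / (2 * v) - ε)) =
      Real.exp ε * Real.exp (-B / (2 * v)) := by
    rw [← Real.exp_add, ← Real.exp_add]
    congr 1
    ring
  have h₂ : Real.exp (-A / (2 * v)) * Real.exp (α * ((B - A) / (2 * v) - ε)) =
      Real.exp (α * (α + 1) * N / (2 * v) - α * ε) *
        Real.exp (-((1 + α) * A - α * B + α * (α + 1) * N) / (2 * v)) := by
    rw [← Real.exp_add, ← Real.exp_add]
    congr 1
    ring
  have h : Real.exp (-A / (2 * v)) ≤ Real.exp ε * Real.exp (-B / (2 * v)) +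
      1 / 2 * (Real.exp (α * (α + 1) * N / (2 * v) - α * ε) *
        Real.exp (-((1 + α) * A - α * B + α * (α + 1) * N) / (2 * v))) := by
    rw [← h₁, ← h₂]
    linarith
  calc _ ≤ (√(2 * Real.pi * v))⁻¹ ^ n * _ := mul_le_mul_of_nonneg_left h (by positivity)
    _ = _ := by ring

theorem pi_gaussianReal_le {n : ℕ} (a b : Fin n → ℝ) {v : NNReal} (hv : v ≠ 0)
    {α ε δ : ℝ} (hα : 1 / 2 ≤ α)
    (hδ : 1 / 2 * Real.exp (α * (α + 1) * (∑ i, (a i - b i) ^ 2) / (2 * v) - α * ε) ≤ δ)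
    {S : Set (Fin n → ℝ)} (hS : MeasurableSet S) :
    Measure.pi (fun i ↦ gaussianReal (a i) v) S ≤
      ENNReal.ofReal (Real.exp ε) * Measure.pi (fun i ↦ gaussianReal (b i) v) S +
        ENNReal.ofReal δ := by
  have hmeas (d : Fin n → ℝ) :
      Measurable fun x : Fin n → ℝ ↦ ENNReal.ofReal (∏ i, gaussianPDFReal (d i) v (x i)) :=
    (Finset.measurable_fun_prod _ fun i _ ↦
      (measurable_gaussianPDFReal (d i) v).comp (measurable_pi_apply i)).ennreal_ofReal
  have hnn (d x : Fin n → ℝ) : 0 ≤ ∏ i, gaussianPDFReal (d i) v (x i) :=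
    Finset.prod_nonneg fun i _ ↦ gaussianPDFReal_nonneg _ _ _
  have hδ₀ : 0 ≤ δ := le_trans (by positivity) hδ
  let d : Fin n → ℝ := fun i ↦ a i + α * (a i - b i)
  calc Measure.pi (fun i ↦ gaussianReal (a i) v) S
      ≤ ENNReal.ofReal (Real.exp ε) * Measure.pi (fun i ↦ gaussianReal (b i) v) S +
        ENNReal.ofReal δ * Measure.pi (fun i ↦ gaussianReal (d i) v) S := by
        simp_rw [pi_gaussianReal_eq_withDensity _ hv, withDensity_apply _ hS]
        rw [← lintegral_const_mul _ (hmeas b), ← lintegral_const_mul _ (hmeas d),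
          ← lintegral_add_left ((hmeas b).const_mul _)]
        refine lintegral_mono fun x ↦ ?_
        rw [← ENNReal.ofReal_mul (Real.exp_pos ε).le, ← ENNReal.ofReal_mul hδ₀,
          ← ENNReal.ofReal_add (mul_nonneg (Real.exp_pos ε).le (hnn b x))
            (mul_nonneg hδ₀ (hnn d x))]
        refine ENNReal.ofReal_le_ofReal ((prod_gaussianPDFReal_le a b x hv hα ε).trans ?_)
        gcongr
        exact hnn d x
    _ ≤ _ := by
        gcongr
        exact mul_le_of_le_one_right' prob_le_one

theorem exists_half_mul_exp_le {ε δ c : ℝ} (hε : ε ∈ Set.Ioo (0 : ℝ) 1)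
    (hδ : δ ∈ Set.Ioo (0 : ℝ) 1) (hc : 0 < c) (hc2 : c ^ 2 > 2 * Real.log (1.25 / δ)) :
    ∃ α : ℝ, 1 / 2 ≤ α ∧
      1 / 2 * Real.exp (α * (α + 1) * (ε ^ 2 / c ^ 2) / 2 - α * ε) ≤ δ := by
  obtain ⟨hε₀, hε₁⟩ := hε
  obtain ⟨hδ₀, hδ₁⟩ := hδ
  have hc2_lower : 2 / 5 ≤ c ^ 2 := by
    have h : 1 - (1.25 / δ)⁻¹ ≤ Real.log (1.25 / δ) :=
      Real.one_sub_inv_le_log_of_pos (by positivity)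
    rw [inv_div] at h
    have h' : δ / 1.25 ≤ 4 / 5 := by
      rw [div_le_iff₀ (by norm_num)]
      linarith
    linarith
  have hδ_lower : 1.25 * Real.exp (-c ^ 2 / 2) ≤ δ := by
    have h : 1.25 / δ ≤ Real.exp (c ^ 2 / 2) :=
      (Real.log_le_iff_le_exp (by positivity)).1 (by linarith)
    rw [neg_div, Real.exp_neg, ← div_eq_mul_inv, div_le_iff₀ (Real.exp_pos _)]
    rwa [div_le_iff₀ hδ₀, mul_comm] at h
  have hexp : Real.exp (3 / 4) ≤ 2.5 := by
    refine le_of_pow_le_pow_left₀ (n := 4) (by norm_num) (by norm_num) ?_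
    rw [← Real.exp_nat_mul]
    have h : Real.exp 1 ^ 3 ≤ 3 ^ 3 :=
      pow_le_pow_left₀ (Real.exp_pos 1).le Real.exp_one_lt_three.le 3
    rw [← Real.exp_nat_mul] at h
    norm_num at h ⊢
    linarith
  suffices ∃ α : ℝ, 1 / 2 ≤ α ∧
      α * (α + 1) * (ε ^ 2 / c ^ 2) / 2 - α * ε ≤ 3 / 4 + -c ^ 2 / 2 by
    obtain ⟨α, hα, h⟩ := this
    refine ⟨α, hα, ?_⟩
    have h' := Real.exp_le_exp.2 h
    rw [Real.exp_add] at h'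
    nlinarith [mul_le_mul_of_nonneg_right hexp (Real.exp_pos (-c ^ 2 / 2)).le]
  have hu : 0 < c ^ 2 := by positivity
  generalize c ^ 2 = u at *
  rcases le_total u ε with h | h
  · refine ⟨1 / 2, le_rfl, ?_⟩
    have : 1 / 2 * (1 / 2 + 1) * (ε ^ 2 / u) / 2 ≤ 3 / 4 + -u / 2 + 1 / 2 * ε := by
      rw [← mul_div_assoc, div_div, div_le_iff₀ (by positivity)]
      nlinarith
    linarith
  · refine ⟨u / ε - 1 / 2, ?_, ?_⟩
    · have : 1 ≤ u / ε := (one_le_div hε₀).2 h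
      linarith
    · have : (u / ε - 1 / 2) * (u / ε - 1 / 2 + 1) * (ε ^ 2 / u) / 2 - (u / ε - 1 / 2) * ε =
          ε / 2 - u / 2 - ε ^ 2 / (8 * u) := by
        field_simp
        ring
      have : 0 ≤ ε ^ 2 / (8 * u) := by positivity
      linarith

/-- The Gaussian mechanism: if `‖a - b‖₂ ≤ Δ` and `σ ≥ cΔ/ε` with `c² > 2 ln(1.25/δ)`, then the
product Gaussian measures centered at `a` and `b` with coordinatewise variance `σ²` are
`(ε, δ)`-indistinguishable. -/
theorem gaussian_mechanism
    (m : ℕ) (a b : Fin m → ℝ) (Δ ε δ c σ : ℝ)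
    (hΔ : 0 < Δ) (hab : Real.sqrt (∑ i, (a i - b i) ^ 2) ≤ Δ)
    (hε : ε ∈ Set.Ioo (0 : ℝ) 1) (hδ : δ ∈ Set.Ioo (0 : ℝ) 1)
    (hc : 0 < c) (hc2 : c ^ 2 > 2 * Real.log (1.25 / δ))
    (hσ : σ ≥ c * Δ / ε) :
    ∀ S : Set (Fin m → ℝ), MeasurableSet S →
      Measure.pi (fun i => gaussianReal (a i) ⟨σ ^ 2, sq_nonneg σ⟩) S ≤
        ENNReal.ofReal (Real.exp ε) *
          Measure.pi (fun i => gaussianReal (b i) ⟨σ ^ 2, sq_nonneg σ⟩) S +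
          ENNReal.ofReal δ := by
  intro S hS
  obtain ⟨α, hα, hαδ⟩ := exists_half_mul_exp_le hε hδ hc hc2
  have hε₀ := hε.1
  have hσ₀ : 0 < σ := lt_of_lt_of_le (by positivity) hσ
  have hv : (⟨σ ^ 2, sq_nonneg σ⟩ : NNReal) ≠ 0 := fun h ↦
    (pow_pos hσ₀ 2).ne' (congrArg NNReal.toReal h)
  refine pi_gaussianReal_le a b hv hα (le_trans ?_ hαδ) hS
  have hN : ∑ i, (a i - b i) ^ 2 ≤ Δ ^ 2 := (Real.sqrt_le_left hΔ.le).1 hab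
  have hratio : (∑ i, (a i - b i) ^ 2) / σ ^ 2 ≤ ε ^ 2 / c ^ 2 := by
    rw [div_le_div_iff₀ (by positivity) (by positivity)]
    have h : (c * Δ) ^ 2 ≤ (σ * ε) ^ 2 :=
      pow_le_pow_left₀ (by positivity) ((div_le_iff₀ hε₀).1 hσ) 2
    nlinarith [mul_le_mul_of_nonneg_right hN (sq_nonneg c)]
  have heq : α * (α + 1) * (∑ i, (a i - b i) ^ 2) / (2 * σ ^ 2) =
      α * (α + 1) * ((∑ i, (a i - b i) ^ 2) / σ ^ 2) / 2 := by
    field_simp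
  change 1 / 2 * Real.exp (α * (α + 1) * (∑ i, (a i - b i) ^ 2) / (2 * σ ^ 2) - α * ε) ≤ _
  rw [heq]
  gcongr
end

section
/- Let H be a symmetric m × m real matrix and λ ≥ 0, λ_max > 0 be such that 0 ≼ H ≼ λ_max·I and H + λ·I is positive definite, and let V be a symmetric positive-definite m × m matrix with V ≽ H + λ·I. Then for every θ ∈ ℝᵐ, ‖(H + λ·I)·θ‖_{V⁻¹} ≤ √(λ_max + λ) · ‖θ‖₂. -/
open Matrix

/-- If `A` is positive semidefinite, `V` is positive definite and `A ≼ V`, then `A V⁻¹ A ≼ A`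
as quadratic forms. -/
theorem Matrix.PosSemidef.mulVec_dotProduct_inv_mulVec_le {n : Type*} [Fintype n] [DecidableEq n]
    {A V : Matrix n n ℝ} (hA : A.PosSemidef) (hV : V.PosDef) (hVA : (V - A).PosSemidef)
    (x : n → ℝ) : (A *ᵥ x) ⬝ᵥ V⁻¹ *ᵥ (A *ᵥ x) ≤ x ⬝ᵥ A *ᵥ x := by
  obtain ⟨y, hy⟩ : ∃ y, y = V⁻¹ *ᵥ (A *ᵥ x) := ⟨_, rfl⟩
  have hVy : V *ᵥ y = A *ᵥ x := by
    rw [hy, mulVec_mulVec, mul_nonsing_inv _ ((isUnit_iff_isUnit_det V).mp hV.isUnit),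
      one_mulVec]
  have hsymm : x ⬝ᵥ A *ᵥ y = y ⬝ᵥ A *ᵥ x := by
    have hAt : Aᵀ = A := by simpa using hA.isHermitian.eq
    rw [dotProduct_mulVec, ← mulVec_transpose, hAt, dotProduct_comm]
  have hdiff := hA.dotProduct_mulVec_nonneg (x - y)
  have hle := hVA.dotProduct_mulVec_nonneg y
  simp only [star_trivial, sub_mulVec, mulVec_sub, dotProduct_sub, sub_dotProduct, hVy]
    at hdiff hle
  rw [← hy, dotProduct_comm]
  linarith

/-- Bound on the regularizer term: if `0 ≼ H ≼ λ_max·I`, `H + λI` is positive definite and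
`V ≽ H + λI` is positive definite, then `‖(H + λI)θ‖_{V⁻¹} ≤ √(λ_max + λ)·‖θ‖₂`. -/
theorem regularizer_term_bound
    (m : ℕ) (H V : Matrix (Fin m) (Fin m) ℝ) (lam lamMax : ℝ)
    (hlam : 0 ≤ lam) (hlamMax : 0 < lamMax)
    (hH : H.PosSemidef)
    (hHub : (lamMax • (1 : Matrix (Fin m) (Fin m) ℝ) - H).PosSemidef)
    (hHl : (H + lam • (1 : Matrix (Fin m) (Fin m) ℝ)).PosDef)
    (hV : V.PosDef)
    (hVH : (V - (H + lam • (1 : Matrix (Fin m) (Fin m) ℝ))).PosSemidef)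
    (θ : Fin m → ℝ) :
    Real.sqrt (((H + lam • (1 : Matrix (Fin m) (Fin m) ℝ)) *ᵥ θ) ⬝ᵥ
        V⁻¹ *ᵥ ((H + lam • (1 : Matrix (Fin m) (Fin m) ℝ)) *ᵥ θ)) ≤
      Real.sqrt (lamMax + lam) * Real.sqrt (θ ⬝ᵥ θ) := by
  have hquad := hHl.posSemidef.mulVec_dotProduct_inv_mulVec_le hV hVH θ
  have hub := hHub.dotProduct_mulVec_nonneg θ
  rw [← Real.sqrt_mul (by linarith)]
  refine Real.sqrt_le_sqrt (hquad.trans ?_)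
  simp only [star_trivial, sub_mulVec, add_mulVec, smul_mulVec, one_mulVec, dotProduct_sub,
    dotProduct_add, dotProduct_smul, smul_eq_mul] at hub ⊢
  linarith
end

section
/- Let Φ be a t × m real matrix, H a symmetric positive-semidefinite m × m matrix, λ > 0, and set V = Φᵀ·Φ + H + λ·I (so V is symmetric positive definite). Let θ̂ ∈ ℝᵐ, e ∈ ℝᵗ, and z = Φ·θ̂ + e. Then ‖θ̂ − V⁻¹·Φᵀ·z‖_V = ‖(H + λ·I)·θ̂ − Φᵀ·e‖_{V⁻¹}. -/
open Matrix

/-- The key algebraic identity for the regularized least-squares estimator: with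
`V = ΦᵀΦ + H + λI` and `z = Φθ̂ + e`,
`‖θ̂ - V⁻¹Φᵀz‖_V = ‖(H + λI)θ̂ - Φᵀe‖_{V⁻¹}`. -/
theorem rls_error_identity
    (t m : ℕ) (Φ : Matrix (Fin t) (Fin m) ℝ) (H : Matrix (Fin m) (Fin m) ℝ)
    (hH : H.PosSemidef) (lam : ℝ) (hlam : 0 < lam)
    (V : Matrix (Fin m) (Fin m) ℝ)
    (hV : V = Φᵀ * Φ + H + lam • (1 : Matrix (Fin m) (Fin m) ℝ))
    (θhat : Fin m → ℝ) (e : Fin t → ℝ) (z : Fin t → ℝ) (hz : z = Φ *ᵥ θhat + e) :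
    Real.sqrt ((θhat - V⁻¹ *ᵥ (Φᵀ *ᵥ z)) ⬝ᵥ V *ᵥ (θhat - V⁻¹ *ᵥ (Φᵀ *ᵥ z))) =
      Real.sqrt
        (((H + lam • (1 : Matrix (Fin m) (Fin m) ℝ)) *ᵥ θhat - Φᵀ *ᵥ e) ⬝ᵥ
          V⁻¹ *ᵥ ((H + lam • (1 : Matrix (Fin m) (Fin m) ℝ)) *ᵥ θhat - Φᵀ *ᵥ e)) := by
  have hV_pos : V.PosDef := by
    rw [hV]
    have hΦ : (Φᵀ * Φ).PosSemidef := by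
      simpa using posSemidef_conjTranspose_mul_self Φ
    exact (PosDef.one.smul hlam).posSemidef_add (hΦ.add hH)
  have hdet : IsUnit V.det := V.isUnit_iff_isUnit_det.mp hV_pos.isUnit
  have hVd : V *ᵥ (θhat - V⁻¹ *ᵥ (Φᵀ *ᵥ z)) =
      (H + lam • (1 : Matrix (Fin m) (Fin m) ℝ)) *ᵥ θhat - Φᵀ *ᵥ e := by
    rw [mulVec_sub, mulVec_mulVec, mul_nonsing_inv V hdet, one_mulVec, hz, hV,
      mulVec_add, mulVec_mulVec, add_assoc, add_mulVec (Φᵀ * Φ)]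
    abel
  rw [← hVd, mulVec_mulVec _ V⁻¹ V, nonsing_inv_mul V hdet, one_mulVec, dotProduct_comm]
end

section
/- Let t, m ∈ ℕ, λ > 0, 0 < λ_min ≤ λ_max, B ≥ 0, ε ≥ 0. Let Φ be a t × m real matrix whose rows φ₁, …, φ_t satisfy ‖φ_τ‖₂ ≤ 1; let H be a symmetric m × m matrix with λ_min·I ≼ H ≼ λ_max·I; let h ∈ ℝᵐ; and set V = Φᵀ·Φ + H + λ·I. Let θ̂ ∈ ℝᵐ with ‖θ̂‖₂ ≤ B, let e ∈ ℝᵗ, let d ∈ ℝᵗ with |d_τ| ≤ B·ε for all τ, let y = Φ·θ̂ + e − d, and let θ̃ = V⁻¹·(Φᵀ·y + h). Then for every φ ∈ ℝᵐ: |⟨θ̂ − θ̃, φ⟩| ≤ ‖φ‖_{V⁻¹} · ( B·√(λ_max + λ) + ‖Φᵀ·e‖_{(ΦᵀΦ + (λ + λ_min)·I)⁻¹} + t·B·ε/√λ_min + ‖h‖_{H⁻¹} ). -/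
open Matrix

/-- Cauchy–Schwarz inequality for the form of a positive semidefinite matrix. -/
theorem abs_dotProduct_mulVec_le_of_posSemidef {n : Type*} [Fintype n] {M : Matrix n n ℝ}
    (hM : M.PosSemidef) (x y : n → ℝ) :
    |x ⬝ᵥ M *ᵥ y| ≤ Real.sqrt (y ⬝ᵥ M *ᵥ y) * Real.sqrt (x ⬝ᵥ M *ᵥ x) := by
  have hnonneg (z : n → ℝ) : 0 ≤ z ⬝ᵥ M *ᵥ z := by
    simpa using hM.dotProduct_mulVec_nonneg z
  have hsymm : y ⬝ᵥ M *ᵥ x = x ⬝ᵥ M *ᵥ y := by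
    have hT : Mᵀ = M := by simpa using hM.isHermitian.eq
    rw [dotProduct_mulVec, ← mulVec_transpose, hT, dotProduct_comm]
  have hdisc := discrim_le_zero (a := y ⬝ᵥ M *ᵥ y) (b := 2 * (x ⬝ᵥ M *ᵥ y))
    (c := x ⬝ᵥ M *ᵥ x) (fun s => by
      have hs := hnonneg (x + s • y)
      simp only [mulVec_add, mulVec_smul, dotProduct_add, add_dotProduct, smul_dotProduct,
        dotProduct_smul, smul_eq_mul, hsymm] at hs
      linarith)
  rw [← Real.sqrt_mul (hnonneg y)]
  apply Real.abs_le_sqrt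
  rw [discrim] at hdisc
  linarith

/-- Matrix inversion is antitone in the Löwner order, in terms of quadratic forms. -/
theorem dotProduct_inv_mulVec_le_of_posSemidef_sub {n : Type*} [Fintype n] [DecidableEq n]
    {V W : Matrix n n ℝ} (hW : W.PosDef) (hVW : (V - W).PosSemidef) (x : n → ℝ) :
    x ⬝ᵥ V⁻¹ *ᵥ x ≤ x ⬝ᵥ W⁻¹ *ᵥ x := by
  have hV : V.PosDef := by simpa using hW.add_posSemidef hVW
  have hVx : V *ᵥ (V⁻¹ *ᵥ x) = x := by
    rw [mulVec_mulVec, mul_nonsing_inv _ hV.det_pos.ne'.isUnit, one_mulVec]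
  have hWx : W *ᵥ (W⁻¹ *ᵥ x) = x := by
    rw [mulVec_mulVec, mul_nonsing_inv _ hW.det_pos.ne'.isUnit, one_mulVec]
  set a := V⁻¹ *ᵥ x
  set b := W⁻¹ *ᵥ x
  have hT : Wᵀ = W := by simpa using hW.isHermitian.eq
  have hba : b ⬝ᵥ W *ᵥ a = x ⬝ᵥ a := by
    rw [dotProduct_mulVec, ← mulVec_transpose, hT, hWx]
  have h₁ : 0 ≤ (a - b) ⬝ᵥ W *ᵥ (a - b) := by
    simpa using hW.posSemidef.dotProduct_mulVec_nonneg (a - b)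
  have h₂ : 0 ≤ a ⬝ᵥ (V - W) *ᵥ a := by
    simpa using hVW.dotProduct_mulVec_nonneg a
  rw [sub_mulVec, dotProduct_sub, hVx] at h₂
  simp only [mulVec_sub, dotProduct_sub, sub_dotProduct, hWx, hba] at h₁
  rw [dotProduct_comm a x] at h₁ h₂
  rw [dotProduct_comm b x] at h₁
  linarith

/-- A linear combination of `t` vectors in the unit ball, with coefficients bounded by `C`,
has Euclidean norm at most `t * C`. -/
theorem sqrt_dotProduct_transpose_mulVec_le {t m : ℕ} {C : ℝ} (hC : 0 ≤ C)
    {Φ : Matrix (Fin t) (Fin m) ℝ} (hΦ : ∀ τ, Real.sqrt (Φ τ ⬝ᵥ Φ τ) ≤ 1)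
    {d : Fin t → ℝ} (hd : ∀ τ, |d τ| ≤ C) :
    Real.sqrt ((Φᵀ *ᵥ d) ⬝ᵥ (Φᵀ *ᵥ d)) ≤ t * C := by
  set v := Φᵀ *ᵥ d
  have hvv : v ⬝ᵥ v = ∑ τ, d τ * (Φ τ ⬝ᵥ v) := by
    calc v ⬝ᵥ v = d ᵥ* Φ ⬝ᵥ v := by rw [← mulVec_transpose]
      _ = d ⬝ᵥ Φ *ᵥ v := (dotProduct_mulVec d Φ v).symm
      _ = ∑ τ, d τ * (Φ τ ⬝ᵥ v) := rfl
  have hterm (τ : Fin t) : d τ * (Φ τ ⬝ᵥ v) ≤ C * Real.sqrt (v ⬝ᵥ v) := by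
    have hcs := abs_dotProduct_mulVec_le_of_posSemidef
      (PosSemidef.one (n := Fin m) (R := ℝ)) (Φ τ) v
    simp only [one_mulVec] at hcs
    calc d τ * (Φ τ ⬝ᵥ v) ≤ |d τ| * |Φ τ ⬝ᵥ v| := by
          rw [← abs_mul]; exact le_abs_self _
      _ ≤ C * Real.sqrt (v ⬝ᵥ v) := by
          refine mul_le_mul (hd τ) (hcs.trans ?_) (abs_nonneg _) hC
          exact mul_le_of_le_one_right (Real.sqrt_nonneg _) (hΦ τ)
  have hsum : v ⬝ᵥ v ≤ t * C * Real.sqrt (v ⬝ᵥ v) := by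
    calc v ⬝ᵥ v ≤ ∑ _τ : Fin t, C * Real.sqrt (v ⬝ᵥ v) :=
          hvv.le.trans (Finset.sum_le_sum fun τ _ => hterm τ)
      _ = t * C * Real.sqrt (v ⬝ᵥ v) := by simp [mul_assoc]
  have hsq : Real.sqrt (v ⬝ᵥ v) * Real.sqrt (v ⬝ᵥ v) = v ⬝ᵥ v :=
    Real.mul_self_sqrt (by simpa using dotProduct_star_self_nonneg v)
  rcases (Real.sqrt_nonneg (v ⬝ᵥ v)).eq_or_lt with h0 | hpos
  · rw [← h0]; positivity
  · exact le_of_mul_le_mul_right (by rwa [hsq]) hpos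

/-- Deterministic core of the β_t concentration theorem: the privatized regularized
least-squares estimate `θ̃ = V⁻¹(Φᵀy + h)` with `V = ΦᵀΦ + H + λI`, `y = Φθ̂ + e - d`,
satisfies, for every feature vector `φ`,
`|⟨θ̂ - θ̃, φ⟩| ≤ ‖φ‖_{V⁻¹}·(B√(λ_max+λ) + ‖Φᵀe‖_{(ΦᵀΦ+(λ+λ_min)I)⁻¹} + tBε/√λ_min + ‖h‖_{H⁻¹})`. -/
theorem beta_concentration_deterministic
    (t m : ℕ) (lam lamMin lamMax B ε : ℝ)
    (hlam : 0 < lam) (hlamMin : 0 < lamMin) (hlamOrd : lamMin ≤ lamMax)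
    (hB : 0 ≤ B) (hε : 0 ≤ ε)
    (Φ : Matrix (Fin t) (Fin m) ℝ)
    (hΦ : ∀ τ : Fin t, Real.sqrt (Φ τ ⬝ᵥ Φ τ) ≤ 1)
    (H : Matrix (Fin m) (Fin m) ℝ) (hHsymm : H.IsSymm)
    (hHl : (H - lamMin • (1 : Matrix (Fin m) (Fin m) ℝ)).PosSemidef)
    (hHu : (lamMax • (1 : Matrix (Fin m) (Fin m) ℝ) - H).PosSemidef)
    (h : Fin m → ℝ)
    (V : Matrix (Fin m) (Fin m) ℝ)
    (hV : V = Φᵀ * Φ + H + lam • (1 : Matrix (Fin m) (Fin m) ℝ))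
    (θhat : Fin m → ℝ) (hθhat : Real.sqrt (θhat ⬝ᵥ θhat) ≤ B)
    (e : Fin t → ℝ) (d : Fin t → ℝ) (hd : ∀ τ, |d τ| ≤ B * ε)
    (y : Fin t → ℝ) (hy : y = Φ *ᵥ θhat + e - d)
    (θtilde : Fin m → ℝ) (hθtilde : θtilde = V⁻¹ *ᵥ (Φᵀ *ᵥ y + h)) :
    ∀ φ : Fin m → ℝ,
      |(θhat - θtilde) ⬝ᵥ φ| ≤
        Real.sqrt (φ ⬝ᵥ V⁻¹ *ᵥ φ) *
          (B * Real.sqrt (lamMax + lam) +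
            Real.sqrt ((Φᵀ *ᵥ e) ⬝ᵥ
              (Φᵀ * Φ + (lam + lamMin) • (1 : Matrix (Fin m) (Fin m) ℝ))⁻¹ *ᵥ (Φᵀ *ᵥ e)) +
            t * B * ε / Real.sqrt lamMin +
            Real.sqrt (h ⬝ᵥ H⁻¹ *ᵥ h)) := by
  intro φ
  have hI {c : ℝ} (hc : 0 < c) : (c • (1 : Matrix (Fin m) (Fin m) ℝ)).PosDef :=
    PosDef.one.smul hc
  have hGram : (Φᵀ * Φ).PosSemidef := by
    simpa using posSemidef_conjTranspose_mul_self Φ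
  have hHpos : H.PosDef := by simpa using (hI hlamMin).add_posSemidef hHl
  have hGpos : (H + lam • (1 : Matrix (Fin m) (Fin m) ℝ)).PosDef := hHpos.add (hI hlam)
  have hVpos : V.PosDef := by
    rw [hV, add_assoc]; exact hGpos.posSemidef_add hGram
  have hVinv : V⁻¹.PosSemidef := hVpos.inv.posSemidef
  -- The four contributions, each bounded in the `V⁻¹`-norm.
  set g := (H + lam • (1 : Matrix (Fin m) (Fin m) ℝ)) *ᵥ θhat with hg
  have hreg : Real.sqrt (g ⬝ᵥ V⁻¹ *ᵥ g) ≤ B * Real.sqrt (lamMax + lam) := by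
    have h₁ : g ⬝ᵥ V⁻¹ *ᵥ g ≤ g ⬝ᵥ (H + lam • (1 : Matrix (Fin m) (Fin m) ℝ))⁻¹ *ᵥ g :=
      dotProduct_inv_mulVec_le_of_posSemidef_sub hGpos
        (by rw [hV, add_assoc, add_sub_cancel_right]; exact hGram) g
    have h₂ : (H + lam • (1 : Matrix (Fin m) (Fin m) ℝ))⁻¹ *ᵥ g = θhat := by
      rw [hg, mulVec_mulVec, nonsing_inv_mul _ hGpos.det_pos.ne'.isUnit, one_mulVec]
    have h₃ : 0 ≤ θhat ⬝ᵥ (lamMax • (1 : Matrix (Fin m) (Fin m) ℝ) - H) *ᵥ θhat := by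
      simpa using hHu.dotProduct_mulVec_nonneg θhat
    have h₄ : g ⬝ᵥ θhat = θhat ⬝ᵥ H *ᵥ θhat + lam * (θhat ⬝ᵥ θhat) := by
      rw [hg, dotProduct_comm, add_mulVec, smul_mulVec, one_mulVec, dotProduct_add,
        dotProduct_smul, smul_eq_mul]
    rw [sub_mulVec, smul_mulVec, one_mulVec, dotProduct_sub, dotProduct_smul, smul_eq_mul] at h₃
    rw [h₂, h₄] at h₁
    have h₅ : g ⬝ᵥ V⁻¹ *ᵥ g ≤ θhat ⬝ᵥ θhat * (lamMax + lam) := by linarith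
    calc Real.sqrt (g ⬝ᵥ V⁻¹ *ᵥ g) ≤ Real.sqrt (θhat ⬝ᵥ θhat * (lamMax + lam)) :=
          Real.sqrt_le_sqrt h₅
      _ = Real.sqrt (θhat ⬝ᵥ θhat) * Real.sqrt (lamMax + lam) :=
          Real.sqrt_mul (by simpa using dotProduct_star_self_nonneg θhat) _
      _ ≤ B * Real.sqrt (lamMax + lam) := by gcongr
  have hnoise : Real.sqrt ((Φᵀ *ᵥ e) ⬝ᵥ V⁻¹ *ᵥ (Φᵀ *ᵥ e)) ≤ Real.sqrt ((Φᵀ *ᵥ e) ⬝ᵥ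
      (Φᵀ * Φ + (lam + lamMin) • (1 : Matrix (Fin m) (Fin m) ℝ))⁻¹ *ᵥ (Φᵀ *ᵥ e)) := by
    refine Real.sqrt_le_sqrt (dotProduct_inv_mulVec_le_of_posSemidef_sub
      ((hI (add_pos hlam hlamMin)).posSemidef_add hGram) ?_ _)
    convert hHl using 1
    rw [hV, add_smul]; abel
  have happrox : Real.sqrt ((Φᵀ *ᵥ d) ⬝ᵥ V⁻¹ *ᵥ (Φᵀ *ᵥ d)) ≤
      t * B * ε / Real.sqrt lamMin := by
    have h₁ := dotProduct_inv_mulVec_le_of_posSemidef_sub (V := V) (hI hlamMin) (by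
      have h₀ := (hGram.add hHl).add (hI hlam).posSemidef
      convert h₀ using 1
      rw [hV]; abel) (Φᵀ *ᵥ d)
    have h₂ : (lamMin • (1 : Matrix (Fin m) (Fin m) ℝ))⁻¹ = lamMin⁻¹ • 1 :=
      inv_eq_right_inv (by simp [smul_smul, hlamMin.ne'])
    rw [h₂, smul_mulVec, one_mulVec, dotProduct_smul, smul_eq_mul, inv_mul_eq_div] at h₁
    refine (Real.sqrt_le_sqrt h₁).trans ?_
    rw [Real.sqrt_div' _ hlamMin.le, mul_assoc]
    gcongr
    exact sqrt_dotProduct_transpose_mulVec_le (mul_nonneg hB hε) hΦ hd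
  have hpriv : Real.sqrt (h ⬝ᵥ V⁻¹ *ᵥ h) ≤ Real.sqrt (h ⬝ᵥ H⁻¹ *ᵥ h) := by
    refine Real.sqrt_le_sqrt (dotProduct_inv_mulVec_le_of_posSemidef_sub hHpos ?_ _)
    convert hGram.add (hI hlam).posSemidef using 1
    rw [hV]; abel
  have hdecomp : θhat - θtilde = V⁻¹ *ᵥ (g - Φᵀ *ᵥ e + Φᵀ *ᵥ d - h) := by
    have hθ : θhat = V⁻¹ *ᵥ (V *ᵥ θhat) := by
      rw [mulVec_mulVec, nonsing_inv_mul _ hVpos.det_pos.ne'.isUnit, one_mulVec]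
    have hVθ : V *ᵥ θhat = Φᵀ *ᵥ (Φ *ᵥ θhat) + g := by
      rw [hV, hg, add_assoc, add_mulVec, mulVec_mulVec]
    rw [hθtilde]
    conv_lhs => rw [hθ]
    rw [← mulVec_sub, hVθ, hy, mulVec_sub Φᵀ, mulVec_add Φᵀ]
    congr 1
    abel
  have hsplit : (θhat - θtilde) ⬝ᵥ φ = φ ⬝ᵥ V⁻¹ *ᵥ g - φ ⬝ᵥ V⁻¹ *ᵥ (Φᵀ *ᵥ e) +
      φ ⬝ᵥ V⁻¹ *ᵥ (Φᵀ *ᵥ d) - φ ⬝ᵥ V⁻¹ *ᵥ h := by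
    rw [hdecomp, dotProduct_comm]
    simp only [mulVec_sub, mulVec_add, dotProduct_sub, dotProduct_add]
  have hbound {x : Fin m → ℝ} {c : ℝ} (hx : Real.sqrt (x ⬝ᵥ V⁻¹ *ᵥ x) ≤ c) :
      |φ ⬝ᵥ V⁻¹ *ᵥ x| ≤ Real.sqrt (φ ⬝ᵥ V⁻¹ *ᵥ φ) * c := by
    refine (abs_dotProduct_mulVec_le_of_posSemidef hVinv φ x).trans ?_
    rw [mul_comm]
    gcongr
  have b₁ := abs_le.mp (hbound hreg)
  have b₂ := abs_le.mp (hbound hnoise)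
  have b₃ := abs_le.mp (hbound happrox)
  have b₄ := abs_le.mp (hbound hpriv)
  rw [hsplit, abs_le, mul_add, mul_add, mul_add]
  constructor <;> linarith [b₁.1, b₁.2, b₂.1, b₂.2, b₃.1, b₃.2, b₄.1, b₄.2]
end

section
/- Let D be a nonempty set, k : D × D → ℝ, and Φ : D → ℝᵐ such that sup_{x, y ∈ D} |k(x, y) − ⟨Φ(x), Φ(y)⟩| ≤ ε for some ε ≥ 0. Let I be a finite index set, points (x_j)_{j ∈ I} in D, and coefficients (α_j)_{j ∈ I} with Σ_{j ∈ I} |α_j| ≤ B, and define f : D → ℝ by f(x) = Σ_{j ∈ I} α_j·k(x_j, x). Then the function μ̂(x) = ⟨θ̂, Φ(x)⟩ with θ̂ = Σ_{j ∈ I} α_j·Φ(x_j) satisfies sup_{x ∈ D} |μ̂(x) − f(x)| ≤ B·ε. -/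
open Matrix

/-- Existence of a proximal function: if `Φ` `ε`-uniformly approximates the kernel `k`, then
for `f = Σ_j α_j k(x_j, ·)` with `Σ_j |α_j| ≤ B`, the function `μ̂ = ⟨θ̂, Φ(·)⟩` with
`θ̂ = Σ_j α_j Φ(x_j)` satisfies `sup_x |μ̂(x) - f(x)| ≤ B·ε`. -/
theorem proximal_space_existence
    {D : Type*} [Nonempty D] (m : ℕ)
    (k : D → D → ℝ) (Φ : D → Fin m → ℝ) (ε : ℝ) (hε : 0 ≤ ε)
    (happrox : ∀ x y : D, |k x y - Φ x ⬝ᵥ Φ y| ≤ ε)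
    {ι : Type*} [Fintype ι] (xs : ι → D) (α : ι → ℝ) (B : ℝ)
    (hα : ∑ j, |α j| ≤ B)
    (f : D → ℝ) (hf : ∀ x, f x = ∑ j, α j * k (xs j) x)
    (θhat : Fin m → ℝ) (hθhat : θhat = ∑ j, α j • Φ (xs j)) :
    ∀ x : D, |θhat ⬝ᵥ Φ x - f x| ≤ B * ε := by
  intro x
  have hdiff : θhat ⬝ᵥ Φ x - f x = ∑ j, α j * (Φ (xs j) ⬝ᵥ Φ x - k (xs j) x) := by
    simp only [hθhat, hf, sum_dotProduct, smul_dotProduct, smul_eq_mul, mul_sub,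
      Finset.sum_sub_distrib]
  calc |θhat ⬝ᵥ Φ x - f x|
      = |∑ j, α j * (Φ (xs j) ⬝ᵥ Φ x - k (xs j) x)| := by rw [hdiff]
    _ ≤ ∑ j, |α j * (Φ (xs j) ⬝ᵥ Φ x - k (xs j) x)| := Finset.abs_sum_le_sum_abs _ _
    _ ≤ ∑ j, |α j| * ε := by
        gcongr with j
        rw [abs_mul, abs_sub_comm]
        gcongr
        exact happrox _ _
    _ = (∑ j, |α j|) * ε := (Finset.sum_mul _ _ _).symm
    _ ≤ B * ε := by gcongr
end
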